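/- arXiv:2411.07299 — 4 statements merged into one kernel-verified Lean document; each statement's English description precedes it below -/
import Mathlib

section
/- In the algebra A^tmf, the element x₅ := Pβ − βP squares to zero: (Pβ − βP)·(Pβ − βP) = 0. (This is part of the paper's lemma that x₁ = β, x₅, and x₉ generate an exterior subalgebra of A^tmf.) -/
noncomputable section

abbrev F3 : Type := ZMod 3
abbrev FA : Type := FreeAlgebra F3 (Fin 2)

/-- The generator `β` of the free algebra. -/
def βF : FA := FreeAlgebra.ι F3 0

/-- The generator `P` (the Steenrod power `𝒫¹`) of the free algebra. -/
def PF : FA := FreeAlgebra.ι F3 1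

/-- The relations presenting `A^tmf`: `β² = 0`, `P³ = 0`, and
`βP²β − βPβP − PβPβ = 0`. -/
inductive AtmfRel : FA → FA → Prop
  | beta_sq : AtmfRel (βF * βF) 0
  | P_cube : AtmfRel (PF * PF * PF) 0
  | adem : AtmfRel (βF * PF * PF * βF - βF * PF * βF * PF - PF * βF * PF * βF) 0

/-- The `tmf` Steenrod algebra `A^tmf` of Henriques–Hill at the prime 3. -/
abbrev Atmf : Type := RingQuot AtmfRel

/-- The image of `β` in `A^tmf`. -/
def β : Atmf := RingQuot.mkAlgHom F3 AtmfRel βF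

/-- The image of `P` in `A^tmf`. -/
def P : Atmf := RingQuot.mkAlgHom F3 AtmfRel PF

/-- `x₁ = β`. -/
def x₁ : Atmf := β

/-- `x₅ = 𝒫¹β − β𝒫¹`. -/
def x₅ : Atmf := P * β - β * P

/-- `x₉ = (𝒫¹)²β − β(𝒫¹)²`. -/
def x₉ : Atmf := P * P * β - β * (P * P)

theorem β_mul_β : β * β = 0 := by
  have h := RingQuot.mkAlgHom_rel F3 AtmfRel.beta_sq
  simpa only [β, map_mul, map_zero] using h

theorem β_P_P_β_relation : β * P * P * β - β * P * β * P - P * β * P * β = 0 := by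
  have h := RingQuot.mkAlgHom_rel F3 AtmfRel.adem
  simpa only [β, P, map_sub, map_mul, map_zero] using h

/-- In `A^tmf`, the element `x₅ = 𝒫¹β − β𝒫¹` squares to zero. -/
theorem x₅_sq : x₅ * x₅ = 0 := by
  have expand : x₅ * x₅ =
      -(β * P * P * β - β * P * β * P - P * β * P * β) - P * (β * β) * P := by
    simp only [x₅, mul_sub, sub_mul, mul_assoc]
    abel
  rw [expand, β_P_P_β_relation, β_mul_β]
  simp
end
end

section
/- The quotient of A^tmf by the two-sided ideal generated by β is isomorphic, as an 𝔽₃-algebra, to the truncated polynomial algebra 𝔽₃[X]/(X³); the isomorphism sends the class of P to the class of X. (This identifies the module N₃ = A^tmf/(β) of the paper with ℤ/3[P¹]/((P¹)³).) -/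
noncomputable section

/-- The relation imposing `β = 0`; `RingQuot BetaRel` is the quotient of `A^tmf` by the
two-sided ideal generated by `β`. -/
inductive BetaRel : Atmf → Atmf → Prop
  | beta : BetaRel β 0

/-- `N₃ = A^tmf/(β)`, the quotient of `A^tmf` by the two-sided ideal generated by `β`. -/
abbrev N₃ : Type := RingQuot BetaRel

/-- The truncated polynomial algebra `𝔽₃[X]/(X³)`. -/
abbrev TruncatedPolynomial : Type :=
  Polynomial F3 ⧸ Ideal.span {(Polynomial.X : Polynomial F3) ^ 3}

/-- The class of `X` in `𝔽₃[X]/(X³)`. -/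
def truncX : TruncatedPolynomial :=
  Ideal.Quotient.mk (Ideal.span {(Polynomial.X : Polynomial F3) ^ 3}) Polynomial.X

theorem truncX_mul_self_mul_self : truncX * truncX * truncX = 0 := by
  rw [truncX, ← map_mul, ← map_mul, Ideal.Quotient.eq_zero_iff_mem]
  exact Ideal.subset_span (by simp only [Set.mem_singleton_iff]; ring)

/-- The algebra map from the free algebra to `𝔽₃[X]/(X³)` with `β ↦ 0` and `P ↦ X`. -/
def freeToTrunc : FA →ₐ[F3] TruncatedPolynomial :=
  FreeAlgebra.lift F3 ![0, truncX]

@[simp]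
theorem freeToTrunc_βF : freeToTrunc βF = 0 := by
  simp [freeToTrunc, βF]

@[simp]
theorem freeToTrunc_PF : freeToTrunc PF = truncX := by
  simp [freeToTrunc, PF]

/-- The algebra map `A^tmf → 𝔽₃[X]/(X³)` with `β ↦ 0` and `P ↦ X`. -/
def AtmfToTrunc : Atmf →ₐ[F3] TruncatedPolynomial :=
  RingQuot.liftAlgHom F3 ⟨freeToTrunc, by
    rintro _ _ (_ | _ | _)
    · simp
    · simp [truncX_mul_self_mul_self]
    · simp⟩

@[simp]
theorem AtmfToTrunc_β : AtmfToTrunc β = 0 := by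
  simp [AtmfToTrunc, β]

@[simp]
theorem AtmfToTrunc_P : AtmfToTrunc P = truncX := by
  simp [AtmfToTrunc, P]

/-- The algebra map `A^tmf/(β) → 𝔽₃[X]/(X³)` sending the class of `P` to the class of `X`. -/
def N₃ToTrunc : N₃ →ₐ[F3] TruncatedPolynomial :=
  RingQuot.liftAlgHom F3 ⟨AtmfToTrunc, by
    rintro _ _ ⟨⟩
    simp⟩

@[simp]
theorem N₃ToTrunc_mk (a : Atmf) :
    N₃ToTrunc (RingQuot.mkAlgHom F3 BetaRel a) = AtmfToTrunc a := by
  simp [N₃ToTrunc]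

theorem mk_β_eq_zero : RingQuot.mkAlgHom F3 BetaRel β = 0 := by
  simpa using RingQuot.mkAlgHom_rel F3 BetaRel.beta

theorem P_mul_self_mul_self : P * P * P = 0 := by
  simpa [P] using RingQuot.mkAlgHom_rel F3 AtmfRel.P_cube

/-- The algebra map `𝔽₃[X]/(X³) → A^tmf/(β)` sending the class of `X` to the class of `P`. -/
def truncToN₃ : TruncatedPolynomial →ₐ[F3] N₃ :=
  Ideal.Quotient.liftₐ _ (Polynomial.aeval (RingQuot.mkAlgHom F3 BetaRel P)) <| by
    intro a ha
    obtain ⟨b, rfl⟩ := Ideal.mem_span_singleton.mp ha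
    rw [map_mul, map_pow, Polynomial.aeval_X, ← map_pow, pow_succ, pow_two,
      P_mul_self_mul_self, map_zero, zero_mul]

@[simp]
theorem truncToN₃_truncX : truncToN₃ truncX = RingQuot.mkAlgHom F3 BetaRel P := by
  exact (Ideal.Quotient.lift_mk _ _ _).trans (Polynomial.aeval_X _)

theorem N₃ToTrunc_comp_truncToN₃ :
    N₃ToTrunc.comp truncToN₃ = AlgHom.id F3 TruncatedPolynomial := by
  apply Ideal.Quotient.algHom_ext
  apply Polynomial.algHom_ext
  change N₃ToTrunc (truncToN₃ truncX) = truncX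
  simp

theorem truncToN₃_comp_N₃ToTrunc : truncToN₃.comp N₃ToTrunc = AlgHom.id F3 N₃ := by
  apply RingQuot.ringQuot_ext'
  apply RingQuot.ringQuot_ext'
  apply FreeAlgebra.hom_ext
  funext i
  fin_cases i
  · change truncToN₃ (N₃ToTrunc (RingQuot.mkAlgHom F3 BetaRel β)) =
      RingQuot.mkAlgHom F3 BetaRel β
    simp [mk_β_eq_zero]
  · change truncToN₃ (N₃ToTrunc (RingQuot.mkAlgHom F3 BetaRel P)) =
      RingQuot.mkAlgHom F3 BetaRel P
    simp

/-- `A^tmf/(β)` is isomorphic as an `𝔽₃`-algebra to the truncated polynomial algebra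
`𝔽₃[X]/(X³)`, via an isomorphism sending the class of `P` to the class of `X`. -/
theorem N₃_iso_truncated_polynomial :
    ∃ e : N₃ ≃ₐ[F3] (Polynomial F3 ⧸ Ideal.span {(Polynomial.X : Polynomial F3) ^ 3}),
      e (RingQuot.mkAlgHom F3 BetaRel P) =
        Ideal.Quotient.mk (Ideal.span {(Polynomial.X : Polynomial F3) ^ 3}) Polynomial.X := by
  refine ⟨AlgEquiv.ofAlgHom N₃ToTrunc truncToN₃ N₃ToTrunc_comp_truncToN₃
    truncToN₃_comp_N₃ToTrunc, ?_⟩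
  change N₃ToTrunc (RingQuot.mkAlgHom F3 BetaRel P) = truncX
  simp
end
end

section
/- Let Λ be the exterior algebra over 𝔽₃ on a 3-dimensional vector space, Λ = ExteriorAlgebra 𝔽₃ (Fin 3 → 𝔽₃), and regard 𝔽₃ as a left Λ-module via the augmentation homomorphism Λ → 𝔽₃ (the algebra map sending every ι(m) to 0). Then for every natural number s, the s-th Ext group Ext^s_Λ(𝔽₃, 𝔽₃), computed in the abelian category of Λ-modules, is finite of cardinality 3^((s+1)(s+2)/2); equivalently, it is an 𝔽₃-vector space of dimension (s+1)(s+2)/2. (This is the Koszul-duality computation Ext_ℬ(𝔽₃, 𝔽₃) ≅ 𝔽₃[h₀, y₁, y₂] from the paper's corollary, with the internal grading forgotten: the polynomial generators h₀, y₁, y₂ all sit in homological degree 1, so the degree-s part has dimension equal to the number of monomials of degree s in three variables.) -/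
noncomputable section

open CategoryTheory

/-- The exterior algebra over `𝔽₃` on a 3-dimensional `𝔽₃`-vector space. -/
abbrev Λ : Type := ExteriorAlgebra F3 (Fin 3 → F3)

/-- `𝔽₃` is a left `Λ`-module by restriction of scalars along the augmentation `Λ → 𝔽₃`
(the canonical algebra homomorphism annihilating the image of `ι`). -/
instance : Module Λ F3 :=
  Module.compHom F3 (ExteriorAlgebra.algebraMapInv :
    ExteriorAlgebra F3 (Fin 3 → F3) →ₐ[F3] F3).toRingHom

instance : HasDerivedCategory.{1} (ModuleCat.{0} Λ) := HasDerivedCategory.standard _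

instance : HasExt.{1} (ModuleCat.{0} Λ) := hasExt_of_hasDerivedCategory _

namespace CategoryTheory.ShortComplex.ShortExact

variable {C : Type*} [Category C] [Abelian C] {S : ShortComplex C}

/-- Dimension shifting along a short exact sequence `0 ⟶ S.X₁ ⟶ S.X₂ ⟶ S.X₃ ⟶ 0` with `S.X₂`
projective, when every morphism `S.X₂ ⟶ Y` vanishes on `S.X₁`. -/
lemma bijective_extClass_precomp [HasExt C] (hS : S.ShortExact) [Projective S.X₂] {Y : C}
    (hY : ∀ φ : S.X₂ ⟶ Y, S.f ≫ φ = 0) (n : ℕ) :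
    Function.Bijective (hS.extClass.precomp Y (add_comm 1 n)) := by
  constructor
  · rw [injective_iff_map_eq_zero]
    intro x hx
    obtain ⟨y, rfl⟩ := Abelian.Ext.contravariant_sequence_exact₁ hS Y x (add_comm 1 n) hx
    cases n with
    | zero =>
      obtain ⟨φ, rfl⟩ := (Abelian.Ext.mk₀_bijective _ _).2 y
      simp [hY φ]
    | succ n => simp [Abelian.Ext.eq_zero_of_projective y]
  · intro x
    exact Abelian.Ext.contravariant_sequence_exact₃ hS Y x
      (Abelian.Ext.eq_zero_of_projective _) (add_comm 1 n)

lemma card_hom_X₃ (hS : S.ShortExact) {Y : C} (hY : ∀ φ : S.X₂ ⟶ Y, S.f ≫ φ = 0) :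
    Nat.card (S.X₃ ⟶ Y) = Nat.card (S.X₂ ⟶ Y) := by
  have := hS.epi_g
  refine Nat.card_eq_of_bijective (fun φ => S.g ≫ φ) ⟨fun φ ψ h => ?_, fun φ => ?_⟩
  · exact (cancel_epi S.g).1 h
  · exact ⟨hS.exact.desc φ (hY φ), hS.exact.g_desc φ (hY φ)⟩

end CategoryTheory.ShortComplex.ShortExact

namespace KoszulComplex

section General

open ExteriorAlgebra

variable {R ι : Type*} [CommRing R] [DecidableEq ι]

lemma single_one_le {i : ι} {a : ι → ℕ} (h : a i ≠ 0) : Pi.single i 1 ≤ a := fun j => by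
  obtain rfl | hj := eq_or_ne j i
  · simpa [Nat.one_le_iff_ne_zero] using h
  · simp [hj]

variable (R) in
/-- The generator of the exterior algebra given by the `i`-th standard basis vector. -/
def gen (i : ι) : ExteriorAlgebra R (ι → R) := ExteriorAlgebra.ι R (Pi.single i 1)

variable (R) in
/-- Right contraction with the `i`-th coordinate form. -/
def contract (i : ι) : ExteriorAlgebra R (ι → R) →ₗ[R] ExteriorAlgebra R (ι → R) :=
  CliffordAlgebra.contractRight.flip (LinearMap.proj i)

lemma contract_mul_gen (i j : ι) (x : ExteriorAlgebra R (ι → R)) :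
    contract R i (x * gen R j) = (if i = j then x else 0) - contract R i x * gen R j := by
  refine (CliffordAlgebra.contractRight_mul_ι _ _ _).trans ?_
  simp [contract, gen, Pi.single_apply, ExteriorAlgebra.ι]

lemma gen_mul_gen_self (i : ι) : gen R i * gen R i = 0 := ι_sq_zero _

lemma gen_mul_gen (i j : ι) : gen R i * gen R j = -(gen R j * gen R i) :=
  eq_neg_of_add_eq_zero_left (ι_add_mul_swap _ _)

@[simp]
lemma algebraMapInv_gen (i : ι) : algebraMapInv (gen R i) = 0 := by
  simp [gen, algebraMapInv]

variable [Fintype ι]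

variable (R ι) in
/-- The Koszul differential on families of elements of the exterior algebra indexed by the
monomials in the divided power variables. -/
def d : ((ι → ℕ) → ExteriorAlgebra R (ι → R)) →ₗ[ExteriorAlgebra R (ι → R)]
    ((ι → ℕ) → ExteriorAlgebra R (ι → R)) where
  toFun f a := ∑ i, f (a + Pi.single i 1) * gen R i
  map_add' f g := by
    ext a
    simp [add_mul, Finset.sum_add_distrib]
  map_smul' c f := by
    ext a
    simp [mul_assoc, Finset.mul_sum]

lemma d_apply (f : (ι → ℕ) → ExteriorAlgebra R (ι → R)) (a : ι → ℕ) :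
    d R ι f a = ∑ i, f (a + Pi.single i 1) * gen R i := rfl

lemma d_d (f : (ι → ℕ) → ExteriorAlgebra R (ι → R)) : d R ι (d R ι f) = 0 := by
  ext a
  simp only [d_apply, Finset.sum_mul, Pi.zero_apply]
  refine (Fintype.sum_prod_type' _).symm.trans ?_
  refine Finset.sum_involution (fun p _ => p.swap) (fun p _ => ?_) (fun p _ hp h => hp ?_)
    (fun _ _ => Finset.mem_univ _) (fun p _ => p.swap_swap)
  · rw [Prod.fst_swap, Prod.snd_swap, mul_assoc, mul_assoc, gen_mul_gen p.2,
      add_right_comm a, ← mul_add, neg_add_cancel, mul_zero]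
  · rw [mul_assoc, show p.2 = p.1 from congrArg Prod.fst h, gen_mul_gen_self, mul_zero]

/-- The partial contracting homotopy of the Koszul complex in the `i`-th direction. -/
def homotopy (i : ι) (f : (ι → ℕ) → ExteriorAlgebra R (ι → R)) (a : ι → ℕ) :
    ExteriorAlgebra R (ι → R) :=
  if a i = 0 then 0 else contract R i (f (a - Pi.single i 1))

/-- The effect of the partial contracting homotopy on a cycle. -/
def proj (i : ι) (f : (ι → ℕ) → ExteriorAlgebra R (ι → R)) (a : ι → ℕ) :
    ExteriorAlgebra R (ι → R) :=
  if a i = 0 then contract R i (f a * gen R i) else 0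

lemma eq_proj_add_d_homotopy (i : ι) {f : (ι → ℕ) → ExteriorAlgebra R (ι → R)}
    (hf : d R ι f = 0) : f = proj i f + d R ι (homotopy i f) := by
  ext a
  rw [Pi.add_apply, d_apply, ← Finset.add_sum_erase _ _ (Finset.mem_univ i)]
  by_cases ha : a i = 0
  · rw [Finset.sum_eq_zero]
    · simp [homotopy, proj, ha, contract_mul_gen]
    · intro j hj
      simp [homotopy, ha, Finset.ne_of_mem_erase hj |>.symm]
  · obtain ⟨b, rfl⟩ : ∃ b : ι → ℕ, a = b + Pi.single i 1 := by
      refine ⟨a - Pi.single i 1, (tsub_add_cancel_of_le (single_one_le ha)).symm⟩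
    have h := congrArg (contract R i) (congrFun hf b)
    rw [d_apply, Pi.zero_apply, map_zero, map_sum,
      ← Finset.add_sum_erase _ _ (Finset.mem_univ i), contract_mul_gen, if_pos rfl] at h
    have h' : ∀ j ∈ Finset.univ.erase i,
        homotopy i f (b + Pi.single i 1 + Pi.single j 1) * gen R j =
          -contract R i (f (b + Pi.single j 1) * gen R j) := fun j hj => by
      rw [contract_mul_gen, if_neg (Finset.ne_of_mem_erase hj).symm, zero_sub, neg_neg,
        homotopy, if_neg (by simp), add_right_comm, add_tsub_cancel_right]
    rw [Finset.sum_congr rfl h', Finset.sum_neg_distrib, proj, if_neg ha, zero_add, homotopy,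
      if_neg (by simp), add_tsub_cancel_right, ← sub_eq_add_neg]
    rw [sub_add_eq_add_sub, sub_eq_zero] at h
    exact eq_sub_of_add_eq h

/-- The homogeneous part of degree `s` of the Koszul complex. -/
def deg (R ι : Type*) [CommRing R] [Fintype ι] (s : ℕ) :
    Submodule (ExteriorAlgebra R (ι → R)) ((ι → ℕ) → ExteriorAlgebra R (ι → R)) where
  carrier := {f | ∀ a, ∑ i, a i ≠ s → f a = 0}
  zero_mem' _ _ := rfl
  add_mem' hf hg a ha := by simp [hf a ha, hg a ha]
  smul_mem' c f hf a ha := by simp [hf a ha]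

lemma d_mem_deg {s : ℕ} {f : (ι → ℕ) → ExteriorAlgebra R (ι → R)} (hf : f ∈ deg R ι (s + 1)) :
    d R ι f ∈ deg R ι s := fun a ha => by
  rw [d_apply]
  refine Finset.sum_eq_zero fun i _ => ?_
  rw [hf _ (by simpa [Finset.sum_add_distrib] using ha), zero_mul]

lemma homotopy_mem_deg (i : ι) {s : ℕ} {f : (ι → ℕ) → ExteriorAlgebra R (ι → R)}
    (hf : f ∈ deg R ι s) : homotopy i f ∈ deg R ι (s + 1) := fun a ha => by
  rw [homotopy]
  split_ifs with h
  · rfl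
  · rw [hf _ fun h' => ha ?_, map_zero]
    rw [← tsub_add_cancel_of_le (single_one_le h), ← h']
    simp [Finset.sum_add_distrib]

lemma exists_eq_add_d (T : Finset ι) {s : ℕ} {f : (ι → ℕ) → ExteriorAlgebra R (ι → R)}
    (hf : f ∈ deg R ι s) (hd : d R ι f = 0) :
    ∃ f' ∈ deg R ι s, ∃ g ∈ deg R ι (s + 1), f = f' + d R ι g ∧
      ∀ a, (∃ i ∈ T, a i ≠ 0) → f' a = 0 := by
  induction T using Finset.induction_on with
  | empty => exact ⟨f, hf, 0, zero_mem _, by simp, by simp⟩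
  | insert i T _ ih =>
    obtain ⟨f', hf', g, hg, rfl, hT⟩ := ih
    have hd' : d R ι f' = 0 := by simpa [d_d] using hd
    refine ⟨proj i f', fun a ha => by simp [proj, hf' a ha], g + homotopy i f',
      add_mem hg (homotopy_mem_deg i hf'), ?_, ?_⟩
    · rw [map_add, add_left_comm, add_comm, ← eq_proj_add_d_homotopy i hd', add_comm]
    · rintro a ⟨j, hj, hja⟩
      rcases Finset.mem_insert.1 hj with rfl | hj
      · simp [proj, hja]
      · simp [proj, hT a ⟨j, hj, hja⟩]

lemma exists_d_eq {s : ℕ} {f : (ι → ℕ) → ExteriorAlgebra R (ι → R)}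
    (hf : f ∈ deg R ι (s + 1)) (hd : d R ι f = 0) : ∃ g ∈ deg R ι (s + 2), d R ι g = f := by
  obtain ⟨f', hf', g, hg, rfl, h⟩ := exists_eq_add_d Finset.univ hf hd
  refine ⟨g, hg, ?_⟩
  rw [right_eq_add]
  ext a
  by_cases ha : ∃ i, a i ≠ 0
  · exact h a (by simpa using ha)
  · push Not at ha
    exact hf' a (by simp [ha])

lemma algebraMapInv_d (f : (ι → ℕ) → ExteriorAlgebra R (ι → R)) (a : ι → ℕ) :
    algebraMapInv (d R ι f a) = 0 := by
  simp [d_apply]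

lemma exists_eq_sum_mul_gen (x : ExteriorAlgebra R (ι → R)) :
    ∃ c : ι → ExteriorAlgebra R (ι → R),
      x = algebraMap R _ (algebraMapInv x) + ∑ i, c i * gen R i := by
  induction x using ExteriorAlgebra.induction with
  | algebraMap r => exact ⟨0, by simp [algebraMapInv]⟩
  | ι v =>
    refine ⟨fun i => algebraMap R _ (v i), ?_⟩
    conv_lhs => rw [pi_eq_sum_univ' v]
    simp [algebraMapInv, gen, ← Algebra.smul_def]
  | mul x y hx hy =>
    obtain ⟨b, hb⟩ := hx
    obtain ⟨c, hc⟩ := hy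
    refine ⟨fun i => x * c i + algebraMap R _ (algebraMapInv y) * b i, ?_⟩
    have h₁ : x * ∑ i, c i * gen R i = x * y - x * algebraMap R _ (algebraMapInv y) := by
      rw [← mul_sub, eq_sub_of_add_eq' hc.symm]
    have h₂ : ∑ i, b i * gen R i = x - algebraMap R _ (algebraMapInv x) :=
      eq_sub_of_add_eq' hb.symm
    have h₃ : ∑ i, (x * c i + algebraMap R _ (algebraMapInv y) * b i) * gen R i =
        x * ∑ i, c i * gen R i + algebraMap R _ (algebraMapInv y) * ∑ i, b i * gen R i := by
      simp only [add_mul, mul_assoc, Finset.sum_add_distrib, Finset.mul_sum]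
    rw [h₃, h₁, h₂, mul_sub, map_mul, map_mul, Algebra.commutes (algebraMapInv y) x,
      Algebra.commutes (algebraMapInv y) (algebraMap R _ (algebraMapInv x))]
    abel
  | add x y hx hy =>
    obtain ⟨b, hb⟩ := hx
    obtain ⟨c, hc⟩ := hy
    refine ⟨b + c, ?_⟩
    conv_lhs => rw [hb, hc]
    simp [add_mul, Finset.sum_add_distrib]
    abel

lemma exists_d_eq_of_algebraMapInv {f : (ι → ℕ) → ExteriorAlgebra R (ι → R)}
    (hf : f ∈ deg R ι 0) (h : algebraMapInv (f 0) = 0) : ∃ g ∈ deg R ι 1, d R ι g = f := by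
  obtain ⟨c, hc⟩ := exists_eq_sum_mul_gen (f 0)
  rw [h, map_zero, zero_add] at hc
  have hg : (fun a => ∑ i, if a = Pi.single i 1 then c i else 0) ∈ deg R ι 1 := fun a ha => by
    refine Finset.sum_eq_zero fun i _ => if_neg ?_
    rintro rfl
    simp at ha
  refine ⟨_, hg, ?_⟩
  ext a
  by_cases ha : a = 0
  · have h_inj : ∀ i j : ι, (Pi.single i 1 : ι → ℕ) = Pi.single j 1 ↔ i = j := fun i j => by
      refine ⟨fun h => by_contra fun hij => ?_, fun h => h ▸ rfl⟩
      simpa [hij] using congrFun h i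
    simp [ha, hc, d_apply, h_inj]
  · have ha' : ∑ i, a i ≠ 0 := by simpa [funext_iff] using ha
    rw [hf a ha', d_mem_deg hg a ha']

/-- The monomials of degree `s` in variables indexed by `ι`. -/
abbrev Monomials (ι : Type*) [Fintype ι] (s : ℕ) : Type _ := {a : ι → ℕ // ∑ i, a i = s}

lemma mem_piAntidiag_univ {s : ℕ} (a : ι → ℕ) :
    a ∈ Finset.piAntidiag Finset.univ s ↔ ∑ i, a i = s := by
  simp

instance (s : ℕ) : Fintype (Monomials ι s) := Fintype.subtype _ mem_piAntidiag_univ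

lemma card_monomials (s : ℕ) :
    Nat.card (Monomials ι s) = (Fintype.card ι).multichoose s := by
  rw [Nat.card_eq_fintype_card, Fintype.card_of_subtype _ mem_piAntidiag_univ,
    ← Finset.map_sym_eq_piAntidiag, Finset.card_map, Finset.sym_univ, Finset.card_univ,
    Sym.card_sym_eq_multichoose]

variable (R ι) in
/-- The homogeneous part of degree `s` of the Koszul complex is free on the monomials of
degree `s`. -/
def degEquiv (s : ℕ) :
    deg R ι s ≃ₗ[ExteriorAlgebra R (ι → R)] (Monomials ι s → ExteriorAlgebra R (ι → R)) where
  toFun f a := f.1 a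
  map_add' _ _ := rfl
  map_smul' _ _ := rfl
  invFun f := ⟨fun a => if h : ∑ i, a i = s then f ⟨a, h⟩ else 0, fun _ ha => dif_neg ha⟩
  left_inv f := by
    ext a
    by_cases h : ∑ i, a i = s
    · simp [h]
    · simp [h, f.2 a h]
  right_inv f := by
    ext a
    simp [a.2]

variable (R ι) in
/-- The basis of the homogeneous part of degree `s` of the Koszul complex given by monomials. -/
def degBasis (s : ℕ) :
    Module.Basis (Monomials ι s) (ExteriorAlgebra R (ι → R)) (deg R ι s) :=
  .ofEquivFun (degEquiv R ι s)

end General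

lemma smul_def (x : Λ) (c : F3) : x • c = ExteriorAlgebra.algebraMapInv x * c := rfl

/-- The augmentation `Λ → 𝔽₃` on the degree `0` part of the Koszul complex. -/
def augmentation : deg F3 (Fin 3) 0 →ₗ[Λ] F3 where
  toFun f := ExteriorAlgebra.algebraMapInv (f.1 0)
  map_add' f g := by simp
  map_smul' c f := by simp [smul_def]

lemma linearMap_eq_zero {s : ℕ} (φ : deg F3 (Fin 3) s →ₗ[Λ] F3) (f : deg F3 (Fin 3) s)
    (hf : ∀ a, ExteriorAlgebra.algebraMapInv (f.1 a) = 0) : φ f = 0 := by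
  rw [← (degBasis F3 (Fin 3) s).sum_repr f, map_sum]
  refine Finset.sum_eq_zero fun a _ => ?_
  rw [map_smul, smul_def]
  exact mul_eq_zero_of_left (hf a) _

/-- The syzygies of the trivial module `𝔽₃` in the Koszul resolution. -/
def syzygy : ℕ → ModuleCat.{0} Λ
  | 0 => ModuleCat.of Λ F3
  | s + 1 => ModuleCat.of Λ ((deg F3 (Fin 3) (s + 1)).map (d F3 (Fin 3)))

lemma map_d_le (s : ℕ) : (deg F3 (Fin 3) (s + 1)).map (d F3 (Fin 3)) ≤ deg F3 (Fin 3) s :=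
  Submodule.map_le_iff_le_comap.2 fun _ => d_mem_deg

/-- The inclusion of a syzygy in the Koszul complex. -/
def syzygyι (s : ℕ) : syzygy (s + 1) ⟶ ModuleCat.of Λ (deg F3 (Fin 3) s) :=
  ModuleCat.ofHom (Submodule.inclusion (map_d_le s))

/-- The projection from the Koszul complex to a syzygy. -/
def syzygyπ : ∀ s : ℕ, ModuleCat.of Λ (deg F3 (Fin 3) s) ⟶ syzygy s
  | 0 => ModuleCat.ofHom augmentation
  | s + 1 => ModuleCat.ofHom ((d F3 (Fin 3)).submoduleMap (deg F3 (Fin 3) (s + 1)))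

lemma exact_syzygy (s : ℕ) : Function.Exact (syzygyι s) (syzygyπ s) := by
  intro f
  suffices syzygyπ s f = 0 ↔ f.1 ∈ (deg F3 (Fin 3) (s + 1)).map (d F3 (Fin 3)) from
    this.trans ⟨fun h => ⟨⟨f.1, h⟩, rfl⟩, by rintro ⟨g, rfl⟩; exact g.2⟩
  cases s with
  | zero =>
    refine ⟨fun h => exists_d_eq_of_algebraMapInv f.2 h, ?_⟩
    rintro ⟨g, -, hg⟩
    refine (congrArg (fun k => ExteriorAlgebra.algebraMapInv (k 0)) hg.symm).trans ?_
    exact algebraMapInv_d g 0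
  | succ s =>
    refine ⟨fun h => exists_d_eq f.2 (congrArg Subtype.val h), ?_⟩
    rintro ⟨g, -, hg⟩
    refine Subtype.ext ((congrArg (d F3 (Fin 3)) hg.symm).trans ?_)
    exact d_d g

lemma syzygyπ_surjective (s : ℕ) : Function.Surjective (syzygyπ s) := by
  cases s with
  | zero =>
    intro c
    change F3 at c
    refine ⟨⟨Pi.single 0 (algebraMap F3 Λ c), fun a ha => ?_⟩, ?_⟩
    · refine Pi.single_eq_of_ne ?_ _
      rintro rfl
      simp at ha
    · refine Eq.trans ?_ (ExteriorAlgebra.algebraMap_leftInverse (Fin 3 → F3) c)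
      exact congrArg ExteriorAlgebra.algebraMapInv
        (Pi.single_eq_same (M := fun _ : Fin 3 → ℕ => Λ) 0 (algebraMap F3 Λ c))
  | succ s => exact LinearMap.submoduleMap_surjective _ _

/-- The short exact sequence relating two consecutive syzygies. -/
def syzygyComplex (s : ℕ) : ShortComplex (ModuleCat.{0} Λ) where
  f := syzygyι s
  g := syzygyπ s
  zero := by
    ext x
    exact (exact_syzygy s).apply_apply_eq_zero x

lemma shortExact_syzygyComplex (s : ℕ) : (syzygyComplex s).ShortExact :=
  ModuleCat.shortComplex_shortExact _ (exact_syzygy s)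
    (Submodule.inclusion_injective (map_d_le s)) (syzygyπ_surjective s)

instance (s : ℕ) : Projective (syzygyComplex s).X₂ :=
  ModuleCat.projective_of_free (degBasis F3 (Fin 3) s)

lemma syzygyComplex_f_comp (s : ℕ) (φ : (syzygyComplex s).X₂ ⟶ ModuleCat.of Λ F3) :
    (syzygyComplex s).f ≫ φ = 0 := by
  ext ⟨f, g, hg, rfl⟩
  exact linearMap_eq_zero φ.hom _ (algebraMapInv_d g)

lemma card_hom_deg (s : ℕ) :
    Nat.card (ModuleCat.of Λ (deg F3 (Fin 3) s) ⟶ ModuleCat.of Λ F3) =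
      3 ^ ((s + 1) * (s + 2) / 2) := by
  rw [Nat.card_congr ModuleCat.homEquiv,
    ← Nat.card_congr ((degBasis F3 (Fin 3) s).constr ℕ (M' := F3)).toEquiv, Nat.card_fun,
    card_monomials, Nat.card_zmod, Fintype.card_fin, Nat.multichoose_eq,
    show 3 + s - 1 = s + 2 by lia, Nat.choose_symm_add, Nat.choose_two_right, mul_comm (s + 1)]
  rfl

lemma card_ext_syzygy (n s : ℕ) :
    Nat.card (Abelian.Ext (syzygy s) (ModuleCat.of Λ F3) n) =
      3 ^ ((s + n + 1) * (s + n + 2) / 2) := by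
  induction n generalizing s with
  | zero =>
    rw [Nat.card_congr Abelian.Ext.homEquiv₀, ← card_hom_deg]
    exact (shortExact_syzygyComplex s).card_hom_X₃ (syzygyComplex_f_comp s)
  | succ n ih =>
    rw [show s + (n + 1) = s + 1 + n by lia, ← ih (s + 1)]
    exact (Nat.card_eq_of_bijective _ ((shortExact_syzygyComplex s).bijective_extClass_precomp
      (syzygyComplex_f_comp s) n)).symm

end KoszulComplex

/-- For every natural number `s`, the Ext group `Ext^s_Λ(𝔽₃, 𝔽₃)`, computed in the abelian
category of `Λ`-modules, is finite of cardinality `3 ^ ((s+1)(s+2)/2)`; equivalently, it is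
an `𝔽₃`-vector space of dimension `(s+1)(s+2)/2`. This is the Koszul-duality computation
`Ext_ℬ(𝔽₃, 𝔽₃) ≅ 𝔽₃[h₀, y₁, y₂]` with the internal grading forgotten. -/
theorem ext_exteriorAlgebra_card (s : ℕ) :
    Nat.card (Abelian.Ext (ModuleCat.of Λ F3) (ModuleCat.of Λ F3) s) =
      3 ^ ((s + 1) * (s + 2) / 2) := by
  have h := KoszulComplex.card_ext_syzygy s 0
  rwa [zero_add] at h
end
end

section
/- Let N₃ be the left A^tmf-module A^tmf/(β), the quotient of A^tmf by the two-sided ideal generated by β, and regard 𝔽₃ as a left A^tmf-module via the unique 𝔽₃-algebra homomorphism A^tmf → 𝔽₃ (which necessarily sends β and P to 0, since they are nilpotent). Then for every natural number s, the s-th Ext group Ext^s_{A^tmf}(N₃, 𝔽₃), computed in the abelian category of left A^tmf-modules, is finite of cardinality 3^((s+1)(s+2)/2); equivalently, it is an 𝔽₃-vector space of dimension (s+1)(s+2)/2. (This is the paper's corollary Ext_{A^tmf}(N₃, 𝔽₃) ≅ Ext_ℬ(𝔽₃, 𝔽₃) ≅ 𝔽₃[h₀, y₁, y₂], with the internal grading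 forgotten: h₀, y₁, y₂ all have homological degree 1.) -/
noncomputable section

open CategoryTheory

/-- `N₃` is a left `A^tmf`-module via the quotient map. -/
instance : Module Atmf N₃ := Module.compHom N₃ (RingQuot.mkRingHom BetaRel)

/-- The unique `𝔽₃`-algebra homomorphism `A^tmf → 𝔽₃`: it sends `β` and `P` to `0`
(they are nilpotent, so this is forced). -/
def aug : Atmf →ₐ[F3] F3 :=
  RingQuot.liftAlgHom F3 ⟨FreeAlgebra.lift F3 (fun _ => (0 : F3)), by
    rintro x y h
    induction h with
    | beta_sq => simp [βF]
    | P_cube => simp [PF]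
    | adem => simp [βF, PF]⟩

/-- `𝔽₃` is a left `A^tmf`-module by restriction of scalars along the augmentation. -/
instance : Module Atmf F3 := Module.compHom F3 aug.toRingHom

instance : HasDerivedCategory.{1} (ModuleCat.{0} Atmf) := HasDerivedCategory.standard _

instance : HasExt.{1} (ModuleCat.{0} Atmf) := hasExt_of_hasDerivedCategory _

section Koszul

variable {R : Type*} [Ring R]

/-- The pairs `(j, i)` with `i ≤ j ≤ s`, indexing the monomials of degree `s` in three variables. -/
def koszulIndex (s : ℕ) : Finset (Σ _ : ℕ, ℕ) :=
  (Finset.range (s + 1)).sigma fun j => Finset.range (j + 1)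

theorem mem_koszulIndex {s : ℕ} {p : Σ _ : ℕ, ℕ} :
    p ∈ koszulIndex s ↔ p.2 ≤ p.1 ∧ p.1 ≤ s := by
  simp only [koszulIndex, Finset.mem_sigma, Finset.mem_range]
  omega

theorem card_koszulIndex (s : ℕ) : (koszulIndex s).card = (s + 1) * (s + 2) / 2 := by
  have h := Finset.sum_range_id_mul_two (s + 2)
  rw [Finset.sum_range_succ'] at h
  simp only [koszulIndex, Finset.card_sigma, Finset.card_range]
  simp only [add_zero, show s + 2 - 1 = s + 1 from rfl] at h
  rw [mul_comm (s + 1), ← h, Nat.mul_div_cancel _ two_pos]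

/-- The differential of the Cartan–Koszul complex of three elements acting by right
multiplication. -/
def koszulD (x y z : R) (s : ℕ) : (koszulIndex (s + 1) → R) →ₗ[R] (koszulIndex s → R) where
  toFun a p :=
    a ⟨⟨p.1.1 + 1, p.1.2 + 1⟩, by
      have := mem_koszulIndex.1 p.2; simp only [mem_koszulIndex]; omega⟩ * x +
    a ⟨⟨p.1.1 + 1, p.1.2⟩, by
      have := mem_koszulIndex.1 p.2; simp only [mem_koszulIndex]; omega⟩ * y +
    a ⟨⟨p.1.1, p.1.2⟩, by
      have := mem_koszulIndex.1 p.2; simp only [mem_koszulIndex]; omega⟩ * z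
  map_add' a b := by ext p; simp only [Pi.add_apply]; noncomm_ring
  map_smul' r a := by
    ext p; simp only [Pi.smul_apply, smul_eq_mul, RingHom.id_apply]; noncomm_ring

/-- The elements `x`, `y`, `z` generate an exterior algebra over which `R` is free as a right
module, in the weak form needed for exactness of the Koszul complex. -/
structure IsExteriorRegular (x y z : R) : Prop where
  xx : x * x = 0
  yy : y * y = 0
  zz : z * z = 0
  yx : y * x = -(x * y)
  zx : z * x = -(x * z)
  zy : z * y = -(y * z)
  regular_x : ∀ a, a * x = 0 → ∃ b, a = b * x
  regular_y : ∀ a b, a * y = b * x → ∃ c d, a = c * x + d * y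
  regular_z : ∀ a b c, a * z = b * x + c * y → ∃ d e f, a = d * x + e * y + f * z

namespace IsExteriorRegular

variable {x y z : R}

theorem koszulD_comp (h : IsExteriorRegular x y z) (s : ℕ) (a : koszulIndex (s + 2) → R) :
    koszulD x y z s (koszulD x y z (s + 1) a) = 0 := by
  ext p
  simp only [koszulD, LinearMap.coe_mk, AddHom.coe_mk, add_mul, mul_assoc, h.xx, h.yy, h.zz, h.yx,
    h.zx, h.zy, mul_neg, mul_zero, Pi.zero_apply]
  abel

theorem exists_bicomplex_primitive (h : IsExteriorRegular x y z) (s : ℕ) (a : ℕ → R)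
    (ha : ∀ i ≤ s, a (i + 1) * x + a i * y = 0) :
    ∃ b : ℕ → R, ∀ i ≤ s + 1, b (i + 1) * x + b i * y = a i := by
  suffices H : ∀ n ≤ s + 1, ∃ b : ℕ → R, ∀ i ≤ n, b (i + 1) * x + b i * y = a i from H _ le_rfl
  intro n hn
  induction n with
  | zero =>
    obtain ⟨c, d, hcd⟩ := h.regular_y (a 0) (-a 1) (by
      rw [neg_mul]; exact eq_neg_of_add_eq_zero_right (ha 0 (Nat.zero_le _)))
    refine ⟨fun i => if i = 0 then d else c, fun i hi => ?_⟩
    obtain rfl : i = 0 := by omega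
    simp [hcd]
  | succ n ih =>
    obtain ⟨b, hb⟩ := ih (by omega)
    obtain ⟨c, hc⟩ := h.regular_x (a (n + 1) - b (n + 1) * y) (by
      have h1 := ha n (by omega)
      rw [← hb n le_rfl, add_mul, mul_assoc, mul_assoc, h.yy, mul_zero, add_zero] at h1
      rw [sub_mul, mul_assoc, h.yx, mul_neg, sub_neg_eq_add, h1])
    refine ⟨Function.update b (n + 2) c, fun i hi => ?_⟩
    rw [Function.update_of_ne (by omega : i ≠ n + 2)]
    rcases Nat.lt_or_ge n i with hni | hni
    · obtain rfl : i = n + 1 := by omega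
      rw [Function.update_self, ← hc, sub_add_cancel]
    · rw [Function.update_of_ne (by omega), hb i hni]

theorem exists_tricomplex_primitive (h : IsExteriorRegular x y z) (s : ℕ) (a : ℕ → ℕ → R)
    (ha : ∀ j ≤ s, ∀ i ≤ j, a (j + 1) (i + 1) * x + a (j + 1) i * y + a j i * z = 0) :
    ∃ b : ℕ → ℕ → R, ∀ j ≤ s + 1, ∀ i ≤ j,
      b (j + 1) (i + 1) * x + b (j + 1) i * y + b j i * z = a j i := by
  suffices H : ∀ n ≤ s + 1, ∃ b : ℕ → ℕ → R, ∀ j ≤ n, ∀ i ≤ j,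
      b (j + 1) (i + 1) * x + b (j + 1) i * y + b j i * z = a j i from H _ le_rfl
  intro n hn
  induction n with
  | zero =>
    obtain ⟨c, d, e, hcde⟩ := h.regular_z (a 0 0) (-a 1 1) (-a 1 0) (by
      have h0 := ha 0 (Nat.zero_le _) 0 le_rfl
      rw [eq_neg_of_add_eq_zero_right h0]; noncomm_ring)
    refine ⟨fun j i => if j = 0 then e else if i = 0 then d else c, fun j hj i hi => ?_⟩
    obtain rfl : j = 0 := by omega
    obtain rfl : i = 0 := by omega
    simp [hcde]
  | succ n ih =>
    obtain ⟨b, hb⟩ := ih (by omega)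
    obtain ⟨c, hc⟩ := h.exists_bicomplex_primitive n (fun i => a (n + 1) i - b (n + 1) i * z) (by
      intro i hi
      have h1 := ha n (by omega) i hi
      rw [← hb n le_rfl i hi] at h1
      simp only [add_mul, sub_mul, mul_assoc, h.zz, h.zx, h.zy, mul_neg, mul_zero, add_zero]
        at h1 ⊢
      rw [← h1]; abel)
    refine ⟨Function.update b (n + 2) c, fun j hj i hi => ?_⟩
    rw [Function.update_of_ne (by omega : j ≠ n + 2)]
    rcases Nat.lt_or_ge n j with hnj | hnj
    · obtain rfl : j = n + 1 := by omega
      rw [Function.update_self, hc i hi, sub_add_cancel]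
    · rw [Function.update_of_ne (by omega), hb j hnj i hi]

theorem ker_koszulD (h : IsExteriorRegular x y z) (s : ℕ) :
    LinearMap.ker (koszulD x y z s) = LinearMap.range (koszulD x y z (s + 1)) := by
  refine le_antisymm (fun a ha => ?_) ?_
  · obtain ⟨b, hb⟩ := h.exists_tricomplex_primitive s
      (fun j i => if hp : (⟨j, i⟩ : Σ _ : ℕ, ℕ) ∈ koszulIndex (s + 1) then a ⟨⟨j, i⟩, hp⟩ else 0) (by
        intro j hj i hi
        have := congrFun (LinearMap.mem_ker.1 ha) ⟨⟨j, i⟩, mem_koszulIndex.2 ⟨hi, hj⟩⟩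
        rw [dif_pos (mem_koszulIndex.2 (by simp only; omega)),
          dif_pos (mem_koszulIndex.2 (by simp only; omega)),
          dif_pos (mem_koszulIndex.2 (by simp only; omega))]
        exact this)
    refine ⟨fun p => b p.1.1 p.1.2, ?_⟩
    ext ⟨⟨j, i⟩, hp⟩
    have hp' := mem_koszulIndex.1 hp
    have := hb j hp'.2 i hp'.1
    rw [dif_pos hp] at this
    exact this
  · rintro _ ⟨a, rfl⟩
    exact h.koszulD_comp s a

end IsExteriorRegular

end Koszul

section SkewMatrices

variable {R : Type*} [Ring R]

/-- The relations of `A^tmf` in characteristic three, with the commutators `q = [p, b]` and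
`z = [p, q]`. -/
structure IsTmfSystem (b p q z : R) : Prop where
  three_zsmul : ∀ a : R, (3 : ℤ) • a = 0
  bb : b * b = 0
  ppp : p * p * p = 0
  adem : b * p * p * b - b * p * b * p - p * b * p * b = 0
  q_def : q = p * b - b * p
  z_def : z = p * q - q * p

/-- The image of `b` under the representation `IsTmfSystem.skewRep`. -/
def skewMatrixB (b : R) : Matrix (Fin 4) (Fin 4) R :=
  !![b, 1, 0, 0; 0, -b, 0, 0; 0, 0, -b, 0; 0, 0, 0, -b]

/-- The image of `p` under the representation `IsTmfSystem.skewRep`. -/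
def skewMatrixP (p : R) : Matrix (Fin 4) (Fin 4) R :=
  !![p, 0, 0, 0; 0, p, 1, 0; 0, 0, p, 1; 0, 0, 0, p]

namespace IsTmfSystem

variable {b p q z : R}

theorem qb (h : IsTmfSystem b p q z) : q * b = -(b * q) := by
  have : q * b + b * q = p * (b * b) - (b * b) * p := by rw [h.q_def]; noncomm_ring
  rw [← add_eq_zero_iff_eq_neg, this, h.bb]; simp

theorem qq (h : IsTmfSystem b p q z) : q * q = 0 := by
  have : q * q = -(b * p * p * b - b * p * b * p - p * b * p * b) - p * (b * b) * p := by
    rw [h.q_def]; noncomm_ring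
  rw [this, h.adem, h.bb]; simp

theorem zb (h : IsTmfSystem b p q z) : z * b = -(b * z) := by
  have : z * b + b * z = p * (q * b + b * q) - (q * b + b * q) * p - (2 : ℤ) • (q * q) := by
    rw [h.z_def, h.q_def]; noncomm_ring
  rw [← add_eq_zero_iff_eq_neg, this, h.qb, h.qq]; simp

theorem zq (h : IsTmfSystem b p q z) : z * q = -(q * z) := by
  have : z * q + q * z = p * (q * q) - (q * q) * p := by rw [h.z_def]; noncomm_ring
  rw [← add_eq_zero_iff_eq_neg, this, h.qq]; simp

theorem zp (h : IsTmfSystem b p q z) : z * p = p * z := by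
  have : z * p - p * z = (3 : ℤ) • (p * (p * b * p) - p * b * p * p) - p * p * p * b
      + b * (p * p * p) := by
    rw [h.z_def, h.q_def]; noncomm_ring
  rw [← sub_eq_zero, this, h.three_zsmul, h.ppp]; simp

theorem zz (h : IsTmfSystem b p q z) : z * z = 0 := by
  have h1 : z * z = p * (q * z) - q * z * p := by
    nth_rw 1 [h.z_def]
    rw [sub_mul, mul_assoc q p, ← h.zp]; noncomm_ring
  have h2 : z * z = p * (z * q) - z * q * p := by
    nth_rw 2 [h.z_def]
    rw [mul_sub, ← mul_assoc, h.zp]; noncomm_ring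
  have h3 : z * z = (3 : ℤ) • (z * z) - (z * z + z * z) := by noncomm_ring
  rw [h3, h.three_zsmul]
  nth_rw 1 [h1]
  rw [h2, h.zq]
  noncomm_ring

theorem combination_mul_b (h : IsTmfSystem b p q z) (c d e : R) :
    0 * b + -(d * b) * q + -(e * b) * z = (c * b + d * q + e * z) * b := by
  simp only [add_mul, mul_assoc, h.bb, h.qb, h.zb]
  noncomm_ring

theorem combination_mul_p (h : IsTmfSystem b p q z) (c d e : R) :
    c * p * b + (d * p - c) * q + (e * p - d) * z = (c * b + d * q + e * z) * p := by
  have hb : b * p = p * b - q := by rw [h.q_def]; abel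
  have hq : q * p = p * q - z := by rw [h.z_def]; abel
  simp only [add_mul, sub_mul, mul_assoc, hb, hq, h.zp, mul_sub]
  abel

theorem skewMatrixB_sq (h : IsTmfSystem b p q z) : skewMatrixB b * skewMatrixB b = 0 := by
  ext i j
  fin_cases i <;> fin_cases j <;> simp [skewMatrixB, Matrix.mul_apply, Fin.sum_univ_four, h.bb]

theorem skewMatrixP_cube (h : IsTmfSystem b p q z) :
    skewMatrixP p * skewMatrixP p * skewMatrixP p = 0 := by
  have h3 := h.three_zsmul
  ext i j
  fin_cases i <;> fin_cases j <;>
    simp [skewMatrixP, Matrix.mul_apply, Fin.sum_univ_four, h.ppp]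
  · rw [← h3 (p * p)]; noncomm_ring
  · rw [← h3 p]; abel
  · rw [← h3 (p * p)]; noncomm_ring

theorem skewMatrixB_mul_P (b p : R) : skewMatrixB b * skewMatrixP p =
    !![b * p, p, 1, 0; 0, -(b * p), -b, 0; 0, 0, -(b * p), -b; 0, 0, 0, -(b * p)] := by
  ext i j
  fin_cases i <;> fin_cases j <;> simp [skewMatrixB, skewMatrixP]

theorem skewMatrixP_mul_B (b p : R) : skewMatrixP p * skewMatrixB b =
    !![p * b, p, 0, 0; 0, -(p * b), -b, 0; 0, 0, -(p * b), -b; 0, 0, 0, -(p * b)] := by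
  ext i j
  fin_cases i <;> fin_cases j <;> simp [skewMatrixB, skewMatrixP]

theorem skewMatrix_adem (h : IsTmfSystem b p q z) :
    skewMatrixB b * skewMatrixP p * skewMatrixP p * skewMatrixB b -
      skewMatrixB b * skewMatrixP p * skewMatrixB b * skewMatrixP p -
      skewMatrixP p * skewMatrixB b * skewMatrixP p * skewMatrixB b = 0 := by
  have hA : b * p * (p * b) - b * p * (b * p) - p * b * (p * b) = 0 := by
    simpa only [mul_assoc] using h.adem
  have hB : p * b * b = 0 := by rw [mul_assoc, h.bb, mul_zero]
  have hB' : b * (b * p) = 0 := by rw [← mul_assoc, h.bb, zero_mul]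
  rw [mul_assoc (skewMatrixB b * skewMatrixP p), mul_assoc (skewMatrixB b * skewMatrixP p),
    mul_assoc (skewMatrixP p * skewMatrixB b), skewMatrixB_mul_P, skewMatrixP_mul_B]
  ext i j
  fin_cases i <;> fin_cases j <;> simp [hA, h.bb, hB, hB']
  simp only [mul_assoc]
  abel

/-- A representation by `4 × 4` matrices whose first row consists of the identity and of skew
derivations dual to `b`, `q` and `z`. -/
structure IsSkewRep (b p : R) (Φ : R →+* Matrix (Fin 4) (Fin 4) R) : Prop where
  map_b : Φ b = skewMatrixB b
  map_p : Φ p = skewMatrixP p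
  col_zero : ∀ a i, Φ a i 0 = if i = 0 then a else 0

variable {Φ : R →+* Matrix (Fin 4) (Fin 4) R}

theorem skewRep_q (h : IsTmfSystem b p q z) (hΦ : IsSkewRep b p Φ) :
    Φ q = !![q, 0, -1, 0; 0, -q, 0, 0; 0, 0, -q, 0; 0, 0, 0, -q] := by
  rw [h.q_def, map_sub, map_mul, map_mul, hΦ.map_b, hΦ.map_p]
  ext i j
  fin_cases i <;> fin_cases j <;>
    simp [skewMatrixB, skewMatrixP] <;> abel

theorem skewRep_z (h : IsTmfSystem b p q z) (hΦ : IsSkewRep b p Φ) :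
    Φ z = !![z, 0, 0, 1; 0, -z, 0, 0; 0, 0, -z, 0; 0, 0, 0, -z] := by
  rw [h.z_def, map_sub, map_mul, map_mul, h.skewRep_q hΦ, hΦ.map_p]
  ext i j
  fin_cases i <;> fin_cases j <;>
    simp [skewMatrixP] <;> abel

theorem isExteriorRegular (h : IsTmfSystem b p q z) (hΦ : IsSkewRep b p Φ) :
    IsExteriorRegular b q z where
  xx := h.bb
  yy := h.qq
  zz := h.zz
  yx := h.qb
  zx := h.zb
  zy := h.zq
  regular_x a ha := by
    have := congrFun₂ (congrArg Φ ha) 0 1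
    simp [Matrix.mul_apply, Fin.sum_univ_four, hΦ.map_b, skewMatrixB, hΦ.col_zero] at this
    exact ⟨Φ a 0 1, by rw [← sub_eq_zero, ← this]; abel⟩
  regular_y a c ha := by
    have := congrFun₂ (congrArg Φ ha) 0 2
    simp [Matrix.mul_apply, Fin.sum_univ_four, hΦ.map_b, skewMatrixB, h.skewRep_q hΦ,
      hΦ.col_zero] at this
    refine ⟨Φ c 0 2, -Φ a 0 2, ?_⟩
    rw [neg_mul, ← sub_eq_zero, ← neg_eq_zero, ← sub_eq_zero.2 this]
    abel
  regular_z a c d ha := by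
    have := congrFun₂ (congrArg Φ ha) 0 3
    simp [Matrix.mul_apply, Fin.sum_univ_four, hΦ.map_b, skewMatrixB, h.skewRep_q hΦ,
      h.skewRep_z hΦ, hΦ.col_zero] at this
    refine ⟨-Φ c 0 3, -Φ d 0 3, Φ a 0 3, ?_⟩
    rw [neg_mul, neg_mul, ← sub_eq_zero, ← sub_eq_zero.2 this]
    abel

end IsTmfSystem

end SkewMatrices

namespace Atmf

/-- The commutator `[P, x₅]`, the primitive counterpart of `x₉`. -/
def ζ : Atmf := P * x₅ - x₅ * P

theorem isTmfSystem : IsTmfSystem β P x₅ ζ where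
  three_zsmul a := by
    rw [zsmul_eq_mul, ← map_intCast (algebraMap F3 Atmf), show ((3 : ℤ) : F3) = 0 from rfl,
      map_zero, zero_mul]
  bb := by simpa [β] using RingQuot.mkAlgHom_rel F3 AtmfRel.beta_sq
  ppp := by simpa [P] using RingQuot.mkAlgHom_rel F3 AtmfRel.P_cube
  adem := by simpa [P, β] using RingQuot.mkAlgHom_rel F3 AtmfRel.adem
  q_def := rfl
  z_def := rfl

theorem induction {C : Atmf → Prop} (algebraMap : ∀ r : F3, C (algebraMap F3 Atmf r))
    (beta : C β) (P : C P) (add : ∀ a b, C a → C b → C (a + b))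
    (mul : ∀ a b, C a → C b → C (a * b)) (a : Atmf) : C a := by
  obtain ⟨a, rfl⟩ := RingQuot.mkAlgHom_surjective F3 AtmfRel a
  induction a using FreeAlgebra.induction with
  | grade0 r => rw [AlgHom.commutes]; exact algebraMap r
  | grade1 i =>
    fin_cases i
    · exact beta
    · exact P
  | mul a b ha hb => rw [map_mul]; exact mul _ _ ha hb
  | add a b ha hb => rw [map_add]; exact add _ _ ha hb

/-- The representation of `A^tmf` by `4 × 4` matrices over itself whose first row consists of the
identity and of skew derivations dual to `β`, `x₅` and `ζ`. -/
def skewRep : Atmf →ₐ[F3] Matrix (Fin 4) (Fin 4) Atmf :=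
  RingQuot.liftAlgHom F3 ⟨FreeAlgebra.lift F3 ![skewMatrixB β, skewMatrixP P], by
    rintro x y h
    induction h with
    | beta_sq => simpa [βF] using isTmfSystem.skewMatrixB_sq
    | P_cube => simpa [PF] using isTmfSystem.skewMatrixP_cube
    | adem => simpa [βF, PF] using isTmfSystem.skewMatrix_adem⟩

theorem skewRep_β : skewRep β = skewMatrixB β := by
  change skewRep (RingQuot.mkAlgHom F3 AtmfRel βF) = _
  rw [skewRep, RingQuot.liftAlgHom_mkAlgHom_apply]
  simp [βF]

theorem skewRep_P : skewRep P = skewMatrixP P := by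
  change skewRep (RingQuot.mkAlgHom F3 AtmfRel PF) = _
  rw [skewRep, RingQuot.liftAlgHom_mkAlgHom_apply]
  simp [PF]

theorem isSkewRep : IsTmfSystem.IsSkewRep β P skewRep.toRingHom where
  map_b := skewRep_β
  map_p := skewRep_P
  col_zero a := by
    show ∀ i, skewRep a i 0 = _
    induction a using Atmf.induction with
    | algebraMap r => intro i; rw [AlgHom.commutes, Matrix.algebraMap_matrix_apply]
    | beta => intro i; rw [skewRep_β]; fin_cases i <;> rfl
    | P => intro i; rw [skewRep_P]; fin_cases i <;> rfl
    | add a b ha hb => intro i; rw [map_add, Matrix.add_apply, ha, hb]; split_ifs <;> simp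
    | mul a b ha hb => intro i; rw [map_mul, Matrix.mul_apply]; simp [ha, hb]

theorem isExteriorRegular : IsExteriorRegular β x₅ ζ :=
  isTmfSystem.isExteriorRegular isSkewRep

end Atmf

section ExtComputation

universe u w

open Abelian

variable {R : Type u} [Ring R] {x y z : R} {Y : Type u} [AddCommGroup Y] [Module R Y]

/-- A linear map into a module killed by `x`, `y`, `z` vanishes on Koszul boundaries. -/
theorem map_koszulD_eq_zero (hx : ∀ v : Y, x • v = 0) (hy : ∀ v : Y, y • v = 0)
    (hz : ∀ v : Y, z • v = 0) {s : ℕ} (f : (koszulIndex s → R) →ₗ[R] Y)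
    (a : koszulIndex (s + 1) → R) : f (koszulD x y z s a) = 0 := by
  have : ∀ p, koszulD x y z s a p • f (Pi.single p 1) = 0 := fun p => by
    simp only [koszulD, LinearMap.coe_mk, AddHom.coe_mk, add_smul, mul_smul, hx, hy, hz, smul_zero,
      add_zero]
  rw [pi_eq_sum_univ' (koszulD x y z s a), map_sum]
  refine Finset.sum_eq_zero fun p _ => ?_
  rw [← this p, ← map_smul]

theorem precomp_extClass_bijective [HasExt.{w} (ModuleCat.{u} R)]
    {S : ShortComplex (ModuleCat.{u} R)} (hS : S.ShortExact) [Projective S.X₂]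
    (N : ModuleCat.{u} R) (hN : ∀ g : S.X₂ ⟶ N, S.f ≫ g = 0) (n : ℕ) :
    Function.Bijective (hS.extClass.precomp N (add_comm 1 n)) := by
  refine ⟨(injective_iff_map_eq_zero _).2 fun e he => ?_,
    fun e => Ext.contravariant_sequence_exact₃ hS N e (Ext.eq_zero_of_projective _) (add_comm 1 n)⟩
  obtain ⟨e', rfl⟩ := Ext.contravariant_sequence_exact₁ hS N e (add_comm 1 n) he
  cases n with
  | zero =>
    obtain ⟨g, rfl⟩ := (Ext.mk₀_bijective _ _).2 e'
    rw [Ext.mk₀_comp_mk₀, hN, Ext.mk₀_zero]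
  | succ n => rw [e'.eq_zero_of_projective, Ext.comp_zero]

theorem card_hom_of_koszul_presentation (hx : ∀ v : Y, x • v = 0) (hy : ∀ v : Y, y • v = 0)
    (hz : ∀ v : Y, z • v = 0) {M : Type u} [AddCommGroup M] [Module R M] (j : ℕ)
    (π : (koszulIndex j → R) →ₗ[R] M) (hπ : Function.Surjective π)
    (hker : LinearMap.ker π = LinearMap.range (koszulD x y z j)) :
    Nat.card (M →ₗ[R] Y) = Nat.card Y ^ ((j + 1) * (j + 2) / 2) := by
  have hbij : Function.Bijective fun f : M →ₗ[R] Y => f ∘ₗ π := by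
    refine ⟨fun f g hfg => (LinearMap.cancel_right hπ).1 hfg, fun g => ?_⟩
    have hg : LinearMap.ker π ≤ LinearMap.ker g := by
      rw [hker]
      rintro _ ⟨a, rfl⟩
      exact map_koszulD_eq_zero hx hy hz g a
    refine ⟨(LinearMap.ker π).liftQ g hg ∘ₗ (π.quotKerEquivOfSurjective hπ).symm, ?_⟩
    exact LinearMap.ext fun a => congrArg ((LinearMap.ker π).liftQ g hg)
      ((π.quotKerEquivOfSurjective hπ).symm_apply_apply (Submodule.Quotient.mk a))
  rw [Nat.card_congr (Equiv.ofBijective _ hbij),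
    ← Nat.card_congr ((Pi.basisFun R (koszulIndex j)).constr ℕ (M' := Y)).toEquiv, Nat.card_fun]
  simp [card_koszulIndex]

theorem IsExteriorRegular.card_ext [HasExt.{w} (ModuleCat.{u} R)] (h : IsExteriorRegular x y z)
    (hx : ∀ v : Y, x • v = 0) (hy : ∀ v : Y, y • v = 0) (hz : ∀ v : Y, z • v = 0)
    {M : Type u} [AddCommGroup M] [Module R M] (s j : ℕ)
    (π : (koszulIndex j → R) →ₗ[R] M) (hπ : Function.Surjective π)
    (hker : LinearMap.ker π = LinearMap.range (koszulD x y z j)) :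
    Nat.card (Ext (ModuleCat.of R M) (ModuleCat.of R Y) s) =
      Nat.card Y ^ ((s + j + 1) * (s + j + 2) / 2) := by
  induction s generalizing M j with
  | zero =>
    rw [Nat.card_congr (Ext.homEquiv₀.trans ModuleCat.homEquiv), zero_add]
    exact card_hom_of_koszul_presentation hx hy hz j π hπ hker
  | succ s ih =>
    have hS := LinearMap.shortExact_shortComplexKer hπ
    have : Projective π.shortComplexKer.X₂ :=
      ModuleCat.projective_of_free (Pi.basisFun R (koszulIndex j))
    have hd : ∀ a, koszulD x y z j a ∈ LinearMap.ker π := fun a => hker ▸ ⟨a, rfl⟩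
    have hbij := precomp_extClass_bijective hS (ModuleCat.of R Y) (fun g => by
      ext ⟨a, ha⟩
      obtain ⟨b, rfl⟩ := hker ▸ ha
      exact map_koszulD_eq_zero hx hy hz g.hom b) s
    have hK := ih (j + 1) ((koszulD x y z j).codRestrict (LinearMap.ker π) hd) (by
      rintro ⟨a, ha⟩
      obtain ⟨b, rfl⟩ := hker ▸ ha
      exact ⟨b, rfl⟩) (by rw [LinearMap.ker_codRestrict, h.ker_koszulD])
    rw [show s + 1 + j = s + (j + 1) by omega, ← hK]
    exact (Nat.card_congr (Equiv.ofBijective _ hbij)).symm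

end ExtComputation

namespace Atmf

/-- The left ideal generated by `β`, `x₅` and `ζ`; it is two-sided. -/
def leftIdeal : Submodule Atmf Atmf := Submodule.span Atmf {β, x₅, ζ}

theorem mem_leftIdeal {a : Atmf} : a ∈ leftIdeal ↔ ∃ b c d, b * β + c * x₅ + d * ζ = a := by
  simp [leftIdeal, Submodule.mem_span_triple]

theorem mul_mem_leftIdeal (b : Atmf) : ∀ a ∈ leftIdeal, a * b ∈ leftIdeal := by
  induction b using Atmf.induction with
  | algebraMap r =>
    intro a ha
    rw [← Algebra.commutes]
    exact leftIdeal.smul_mem _ ha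
  | beta =>
    intro a ha
    obtain ⟨c, d, e, rfl⟩ := mem_leftIdeal.1 ha
    exact mem_leftIdeal.2 ⟨_, _, _, isTmfSystem.combination_mul_b c d e⟩
  | P =>
    intro a ha
    obtain ⟨c, d, e, rfl⟩ := mem_leftIdeal.1 ha
    exact mem_leftIdeal.2 ⟨_, _, _, isTmfSystem.combination_mul_p c d e⟩
  | add b c hb hc =>
    intro a ha
    rw [mul_add]
    exact add_mem (hb a ha) (hc a ha)
  | mul b c hb hc =>
    intro a ha
    rw [← mul_assoc]
    exact hc _ (hb a ha)

/-- The two-sided ideal generated by `β`, described by `leftIdeal`. -/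
def twoSidedIdeal : TwoSidedIdeal Atmf :=
  .mk' leftIdeal leftIdeal.zero_mem leftIdeal.add_mem leftIdeal.neg_mem
    (leftIdeal.smul_mem _) (mul_mem_leftIdeal _ _)

theorem mem_twoSidedIdeal {a : Atmf} : a ∈ twoSidedIdeal ↔ a ∈ leftIdeal :=
  TwoSidedIdeal.mem_mk' ..

theorem mkRingHom_β : RingQuot.mkRingHom BetaRel β = 0 :=
  (RingQuot.mkRingHom_rel BetaRel.beta).trans (map_zero _)

theorem mkRingHom_x₅ : RingQuot.mkRingHom BetaRel x₅ = 0 := by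
  rw [x₅, map_sub, map_mul, map_mul, mkRingHom_β, mul_zero, zero_mul]
  exact sub_self _

theorem mkRingHom_ζ : RingQuot.mkRingHom BetaRel ζ = 0 := by
  rw [ζ, map_sub, map_mul, map_mul, mkRingHom_x₅, mul_zero, zero_mul]
  exact sub_self _

theorem mkRingHom_eq_zero_iff {a : Atmf} :
    RingQuot.mkRingHom BetaRel a = 0 ↔ a ∈ leftIdeal := by
  refine ⟨fun h => ?_, fun h => ?_⟩
  · have hβ : β ∈ twoSidedIdeal := mem_twoSidedIdeal.2 (mem_leftIdeal.2 ⟨1, 0, 0, by simp⟩)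
    have hrel : ∀ ⦃a b⦄, BetaRel a b →
        twoSidedIdeal.ringCon.mk' a = twoSidedIdeal.ringCon.mk' b := by
      rintro _ _ ⟨⟩
      exact (RingCon.eq _).2 hβ
    have h' := congrArg (RingQuot.lift ⟨twoSidedIdeal.ringCon.mk', hrel⟩) h
    rw [RingQuot.lift_mkRingHom_apply, map_zero] at h'
    exact mem_twoSidedIdeal.1 ((RingCon.eq _).1 h')
  · obtain ⟨b, c, d, rfl⟩ := mem_leftIdeal.1 h
    simp only [map_add, map_mul, mkRingHom_β, mkRingHom_x₅, mkRingHom_ζ, mul_zero, add_zero]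

theorem aug_smul (a : Atmf) (v : F3) : a • v = aug a * v := rfl

theorem aug_β : aug β = 0 := by
  change aug (RingQuot.mkAlgHom F3 AtmfRel βF) = _
  rw [aug, RingQuot.liftAlgHom_mkAlgHom_apply]
  simp [βF]

theorem aug_x₅ : aug x₅ = 0 := by
  rw [x₅, map_sub, map_mul, map_mul, aug_β, mul_zero, zero_mul, sub_zero]

theorem aug_ζ : aug ζ = 0 := by
  rw [ζ, map_sub, map_mul, map_mul, aug_x₅, mul_zero, zero_mul, sub_zero]

/-- The augmentation of the Koszul resolution of `N₃`. -/
def koszulAug : (koszulIndex 0 → Atmf) →ₗ[Atmf] N₃ where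
  toFun a := RingQuot.mkRingHom BetaRel (a ⟨⟨0, 0⟩, mem_koszulIndex.2 ⟨le_rfl, le_rfl⟩⟩)
  map_add' _ _ := map_add _ _ _
  map_smul' _ _ := map_mul _ _ _

theorem koszulAug_surjective : Function.Surjective koszulAug := fun n => by
  obtain ⟨a, rfl⟩ := RingQuot.mkRingHom_surjective BetaRel n
  exact ⟨fun _ => a, rfl⟩

theorem ker_koszulAug : LinearMap.ker koszulAug = LinearMap.range (koszulD β x₅ ζ 0) := by
  ext a
  rw [LinearMap.mem_ker]
  refine mkRingHom_eq_zero_iff.trans (mem_leftIdeal.trans ⟨?_, ?_⟩)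
  · rintro ⟨b, c, d, h⟩
    refine ⟨fun p => if p.1.1 = 0 then d else if p.1.2 = 0 then c else b, ?_⟩
    ext ⟨⟨j, i⟩, hp⟩
    obtain ⟨hi, hj⟩ := mem_koszulIndex.1 hp
    obtain rfl : j = 0 := by simp only at hj; omega
    obtain rfl : i = 0 := by simp only at hi; omega
    simpa [koszulD] using h
  · rintro ⟨b, rfl⟩
    exact ⟨_, _, _, rfl⟩

end Atmf

/-- For every natural number `s`, the Ext group `Ext^s_{A^tmf}(N₃, 𝔽₃)`, computed in the
abelian category of left `A^tmf`-modules, is finite of cardinality `3 ^ ((s+1)(s+2)/2)`;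
equivalently, it is an `𝔽₃`-vector space of dimension `(s+1)(s+2)/2`. This is the paper's
corollary `Ext_{A^tmf}(N₃, 𝔽₃) ≅ Ext_ℬ(𝔽₃, 𝔽₃) ≅ 𝔽₃[h₀, y₁, y₂]`, with the internal
grading forgotten. -/
theorem ext_N₃_card (s : ℕ) :
    Nat.card (Abelian.Ext (ModuleCat.of Atmf N₃) (ModuleCat.of Atmf F3) s) =
      3 ^ ((s + 1) * (s + 2) / 2) := by
  have h := Atmf.isExteriorRegular.card_ext (Y := F3) (M := N₃)
    (fun v => by rw [Atmf.aug_smul, Atmf.aug_β, zero_mul])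
    (fun v => by rw [Atmf.aug_smul, Atmf.aug_x₅, zero_mul])
    (fun v => by rw [Atmf.aug_smul, Atmf.aug_ζ, zero_mul])
    s 0 (π := Atmf.koszulAug) Atmf.koszulAug_surjective Atmf.ker_koszulAug
  rwa [Nat.card_zmod] at h
end
end
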